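/- Let H be a complex Hilbert space and let a be a (possibly unbounded) linear operator defined on a subspace dom(a) ⊆ H whose graph {(f, a f) : f ∈ dom(a)} is closed in H × H. Let (φₙ)_{n≥0} ⊆ dom(a) satisfy a φ₀ = 0, a φₙ = √n • φ_{n−1} for n ≥ 1, and ‖φₙ‖ ≤ C for all n. Then for every z ∈ ℂ the coherent state φ(z) := e^{−|z|²/2} ∑_{n=0}^∞ (zⁿ/√(n!)) φₙ belongs to dom(a) and is an eigenvector of a with eigenvalue z: a φ(z) = z • φ(z). -/

import Mathlib

/-- The coefficients `rⁿ / √(n!)` are summable for every real `r`. -/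
lemma summable_pow_div_sqrt_factorial (r : ℝ) :
    Summable fun n : ℕ => r ^ n / Real.sqrt n.factorial := by
  have hexp := Real.summable_pow_div_factorial ((2 * r) ^ 2)
  have hgeo := summable_geometric_of_lt_one (r := (1 / 4 : ℝ)) (by norm_num) (by norm_num)
  refine Summable.of_norm_bounded (hexp.add hgeo) fun n => ?_
  have hfac : (0 : ℝ) < n.factorial := by exact_mod_cast n.factorial_pos
  have hleft : ((2 * r) ^ 2) ^ n / (n.factorial : ℝ)
      = ((2 * r) ^ n / Real.sqrt n.factorial) ^ 2 := by
    rw [div_pow, Real.sq_sqrt hfac.le, ← pow_mul, ← pow_mul, mul_comm 2 n]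
  have hright : (1 / 4 : ℝ) ^ n = ((1 / 2 : ℝ) ^ n) ^ 2 := by
    rw [← pow_mul, mul_comm, pow_mul]; norm_num
  have hprod : r ^ n / Real.sqrt n.factorial
      = (2 * r) ^ n / Real.sqrt n.factorial * (1 / 2 : ℝ) ^ n := by
    rw [div_mul_eq_mul_div, ← mul_pow]; congr 2; ring
  rw [hleft, hright, hprod, Real.norm_eq_abs, abs_le]
  constructor <;> nlinarith [sq_nonneg ((2 * r) ^ n / Real.sqrt n.factorial + (1 / 2 : ℝ) ^ n),
    sq_nonneg ((2 * r) ^ n / Real.sqrt n.factorial - (1 / 2 : ℝ) ^ n),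
    sq_nonneg ((2 * r) ^ n / Real.sqrt n.factorial), sq_nonneg ((1 / 2 : ℝ) ^ n)]

/-- Recurrence for the coefficients `zⁿ / √(n!)`. -/
lemma pow_div_sqrt_factorial_succ_mul_sqrt (z : ℂ) (n : ℕ) :
    z ^ (n + 1) / (Real.sqrt (n + 1).factorial : ℂ) * ((Real.sqrt (n + 1 : ℕ) : ℝ) : ℂ)
      = z * (z ^ n / (Real.sqrt n.factorial : ℂ)) := by
  have hfac : (Real.sqrt n.factorial : ℂ) ≠ 0 := by
    exact_mod_cast (Real.sqrt_pos.2 (by exact_mod_cast n.factorial_pos)).ne'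
  have hsucc : ((Real.sqrt (n + 1 : ℕ) : ℝ) : ℂ) ≠ 0 := by
    exact_mod_cast (Real.sqrt_pos.2 (by exact_mod_cast n.succ_pos)).ne'
  rw [Nat.factorial_succ, Nat.cast_mul, Real.sqrt_mul (Nat.cast_nonneg _), Complex.ofReal_mul]
  field_simp
  ring


/-- Let `a` be a closed operator with domain `D ⊆ H` and let
`(φₙ) ⊆ D` satisfy `a φ₀ = 0`, `a φₙ = √n φ_{n-1}` for `n ≥ 1`, and `‖φₙ‖ ≤ C`.
Then each coherent state `φ(z) = e^{-|z|²/2} ∑ₙ (zⁿ/√(n!)) φₙ` belongs to the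
domain of `a` and satisfies `a φ(z) = z φ(z)`. -/
theorem coherent_state_is_eigenvector_of_closed_lowering_operator
    {H : Type*} [NormedAddCommGroup H] [InnerProductSpace ℂ H] [CompleteSpace H]
    (D : Submodule ℂ H) (a : D →ₗ[ℂ] H)
    (hclosed : IsClosed {p : H × H | ∃ f : D, p = ((f : H), a f)})
    (φ : ℕ → H) (hmem : ∀ n : ℕ, φ n ∈ D)
    (ha0 : a ⟨φ 0, hmem 0⟩ = 0)
    (halow : ∀ n : ℕ, 1 ≤ n → a ⟨φ n, hmem n⟩ = ((Real.sqrt n : ℝ) : ℂ) • φ (n - 1))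
    (C : ℝ) (hC : 0 < C) (hbound : ∀ n : ℕ, ‖φ n‖ ≤ C)
    (z : ℂ) (cs : H)
    (hcs : cs = ((Real.exp (-(‖z‖ ^ 2) / 2) : ℝ) : ℂ) •
      ∑' n : ℕ, (z ^ n / (Real.sqrt n.factorial : ℂ)) • φ n) :
    ∃ h : cs ∈ D, a ⟨cs, h⟩ = z • cs := by
  have hsum : Summable fun n : ℕ => (z ^ n / (Real.sqrt n.factorial : ℂ)) • φ n := by
    refine Summable.of_norm_bounded ((summable_pow_div_sqrt_factorial ‖z‖).mul_right C) fun n => ?_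
    rw [norm_smul, norm_div, norm_pow, Complex.norm_real, Real.norm_of_nonneg (Real.sqrt_nonneg _)]
    gcongr
    exact hbound n
  set S : ℕ → D := fun N => ∑ n ∈ Finset.range N,
    (z ^ n / (Real.sqrt n.factorial : ℂ)) • (⟨φ n, hmem n⟩ : D) with hS
  have haS : ∀ N, a (S (N + 1)) = z • (S N : H) := by
    intro N
    simp only [hS, map_sum, map_smul, Submodule.coe_sum, Submodule.coe_smul, Finset.smul_sum]
    rw [Finset.sum_range_succ', ha0, smul_zero, add_zero]
    refine Finset.sum_congr rfl fun n _ => ?_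
    rw [halow (n + 1) (Nat.le_add_left 1 n), smul_smul, smul_smul,
      pow_div_sqrt_factorial_succ_mul_sqrt, Nat.add_sub_cancel]
  have hlim : Filter.Tendsto (fun N => (S N : H)) Filter.atTop
      (nhds (∑' n : ℕ, (z ^ n / (Real.sqrt n.factorial : ℂ)) • φ n)) := by
    simpa only [hS, Submodule.coe_sum, Submodule.coe_smul] using hsum.hasSum.tendsto_sum_nat
  obtain ⟨f, hf⟩ := hclosed.mem_of_tendsto
    ((hlim.comp (Filter.tendsto_add_atTop_nat 1)).prodMk_nhds (hlim.const_smul z))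
    (Filter.Eventually.of_forall fun N => ⟨S (N + 1), by simp [haS]⟩)
  obtain ⟨hf₁, hf₂⟩ := Prod.mk.inj hf
  rw [hf₁] at hcs hf₂
  subst hcs
  refine ⟨D.smul_mem _ f.2, ?_⟩
  change a (((Real.exp (-(‖z‖ ^ 2) / 2) : ℝ) : ℂ) • f) = _
  rw [map_smul, ← hf₂, smul_comm]
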